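/- Let φ : (0,∞) → ℂ be measurable and suppose there exists a > 0 such that ∫₀^∞ e^(a s)·|φ(s)| ds < ∞. If ∫₀^∞ φ(s)·s^k ds = 0 for every natural number k ≥ 0, then φ = 0 almost everywhere on (0,∞). -/

import Mathlib

open MeasureTheory Real Set

open ProbabilityTheory Topology Filter

/-- Two functions analytic at a point with the same iterated derivatives there agree locally. -/
lemma AnalyticAt.eventuallyEq_of_iteratedDeriv_eq {f g : ℂ → ℂ} {z : ℂ}
    (hf : AnalyticAt ℂ f z) (hg : AnalyticAt ℂ g z)
    (h : ∀ n, iteratedDeriv n f z = iteratedDeriv n g z) : f =ᶠ[𝓝 z] g := by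
  have hf' := hf.hasFPowerSeriesAt
  simp only [h] at hf'
  have hsub := hf'.sub hg.hasFPowerSeriesAt
  rw [sub_self] at hsub
  filter_upwards [hsub.eventually_eq_zero] with w hw using sub_eq_zero.mp hw

/-- Finite measures on `ℝ` with exponential moments near `0` are determined by their moments. -/
lemma MeasureTheory.Measure.ext_of_integral_pow_eq {μ ν : Measure ℝ}
    [IsFiniteMeasure μ] [IsFiniteMeasure ν]
    (hμ : 0 ∈ interior (integrableExpSet id μ)) (hν : 0 ∈ interior (integrableExpSet id ν))
    (h : ∀ n : ℕ, ∫ x, x ^ n ∂μ = ∫ x, x ^ n ∂ν) : μ = ν := by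
  let U : Set ℝ := interior (integrableExpSet id μ) ∩ interior (integrableExpSet id ν)
  have hU : Convex ℝ U := convex_integrableExpSet.interior.inter convex_integrableExpSet.interior
  have hμa : AnalyticOnNhd ℂ (complexMGF id μ) {z | z.re ∈ U} :=
    analyticOnNhd_complexMGF.mono fun z hz ↦ hz.1
  have hνa : AnalyticOnNhd ℂ (complexMGF id ν) {z | z.re ∈ U} :=
    analyticOnNhd_complexMGF.mono fun z hz ↦ hz.2
  have h0 : (0 : ℂ) ∈ {z : ℂ | z.re ∈ U} := ⟨by simpa using hμ, by simpa using hν⟩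
  have hloc : complexMGF id μ =ᶠ[𝓝 0] complexMGF id ν := by
    refine (hμa 0 h0).eventuallyEq_of_iteratedDeriv_eq (hνa 0 h0) fun n ↦ ?_
    rw [iteratedDeriv_complexMGF h0.1, iteratedDeriv_complexMGF h0.2]
    simp only [id_eq, zero_mul, Complex.exp_zero, mul_one]
    exact_mod_cast congrArg ((↑) : ℝ → ℂ) (h n)
  have heq := hμa.eqOn_of_preconnected_of_eventuallyEq hνa
    (hU.linear_preimage Complex.reLm).isPreconnected h0 hloc
  refine Measure.ext_of_charFun (funext fun t ↦ ?_)
  rw [← complexMGF_id_mul_I, ← complexMGF_id_mul_I]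
  exact heq (show (t * Complex.I : ℂ).re ∈ U by simpa using ⟨hμ, hν⟩)

lemma zero_mem_interior_integrableExpSet_withDensity {μ : Measure ℝ} {f : ℝ → ℝ}
    (hf : Measurable f) (hint : ∀ᶠ t in 𝓝 0, Integrable (fun x ↦ exp (t * x) * f x) μ) :
    0 ∈ interior (integrableExpSet id (μ.withDensity fun x ↦ ENNReal.ofReal (f x))) := by
  rw [mem_interior_iff_mem_nhds]
  filter_upwards [hint] with t ht
  simp only [integrableExpSet, mem_ofPred_eq, id_eq]
  rw [integrable_withDensity_iff hf.ennreal_ofReal (by simp)]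
  refine ht.pos_part.congr (.of_forall fun x ↦ ?_)
  simp [ENNReal.toReal_ofReal', mul_max_of_nonneg _ _ (exp_pos (t * x)).le]

/-- A real function with exponential decay all of whose moments vanish is zero a.e. -/
lemma ae_eq_zero_of_integral_mul_pow_eq_zero {μ : Measure ℝ} {f : ℝ → ℝ} [SigmaFinite μ]
    (hf : Measurable f) (hint : ∀ᶠ t in 𝓝 0, Integrable (fun x ↦ exp (t * x) * f x) μ)
    (hmom : ∀ n : ℕ, ∫ x, f x * x ^ n ∂μ = 0) : f =ᵐ[μ] 0 := by
  have hp := zero_mem_interior_integrableExpSet_withDensity hf hint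
  have hn := zero_mem_interior_integrableExpSet_withDensity hf.neg
    (hint.mono fun t ht ↦ by simpa using ht.neg)
  have hfi : Integrable f μ := by simpa using hint.self_of_nhds
  have : IsFiniteMeasure (μ.withDensity fun x ↦ ENNReal.ofReal (f x)) :=
    isFiniteMeasure_withDensity_ofReal hfi.2
  have : IsFiniteMeasure (μ.withDensity fun x ↦ ENNReal.ofReal ((-f) x)) :=
    isFiniteMeasure_withDensity_ofReal hfi.neg.2
  have heq := Measure.ext_of_integral_pow_eq hp hn fun n ↦ by
    have hpn := integrable_pow_of_mem_interior_integrableExpSet hp n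
    have hnn := integrable_pow_of_mem_interior_integrableExpSet hn n
    rw [integrable_withDensity_iff_integrable_smul' (by fun_prop) (by simp)] at hpn hnn
    simp only [id_eq] at hpn hnn
    rw [integral_withDensity_eq_integral_toReal_smul (by fun_prop) (by simp),
      integral_withDensity_eq_integral_toReal_smul (by fun_prop) (by simp), ← sub_eq_zero,
      ← integral_sub hpn hnn, ← hmom n]
    congr with x
    simp only [ENNReal.toReal_ofReal', smul_eq_mul, Pi.neg_apply, ← sub_mul,
      max_zero_sub_max_neg_zero_eq_self]
  rw [withDensity_eq_iff_of_sigmaFinite (by fun_prop) (by fun_prop)] at heq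
  filter_upwards [heq] with x hx
  have := congrArg ENNReal.toReal hx
  rw [ENNReal.toReal_ofReal', ENNReal.toReal_ofReal', Pi.neg_apply] at this
  rw [← max_zero_sub_max_neg_zero_eq_self (f x), this, sub_self, Pi.zero_apply]

theorem vanishing_moments_implies_zero
    (φ : ℝ → ℂ) (hφ : Measurable φ) (a : ℝ) (ha : 0 < a)
    (hint : IntegrableOn (fun s : ℝ => Real.exp (a * s) * ‖φ s‖) (Ioi (0:ℝ)) volume)
    (hmom : ∀ k : ℕ, ∫ s in Ioi (0:ℝ), φ s * (s : ℂ) ^ k = 0) :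
    φ =ᵐ[volume.restrict (Ioi (0:ℝ))] 0 := by
  have hpow (k : ℕ) : IntegrableOn (fun s : ℝ ↦ φ s * (s : ℂ) ^ k) (Ioi 0) := by
    refine (hint.const_mul (k.factorial / a ^ k)).mono' (by fun_prop) ?_
    filter_upwards [ae_restrict_mem measurableSet_Ioi] with s (hs : 0 < s)
    have h := pow_div_factorial_le_exp (a * s) (by positivity) k
    rw [mul_pow, div_le_iff₀ (by positivity)] at h
    rw [norm_mul, norm_pow, Complex.norm_real, norm_of_nonneg hs.le, div_mul_eq_mul_div,
      le_div_iff₀ (by positivity)]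
    nlinarith [mul_le_mul_of_nonneg_left h (norm_nonneg (φ s))]
  have key (L : ℂ →L[ℝ] ℝ) : (fun s ↦ L (φ s)) =ᵐ[volume.restrict (Ioi (0:ℝ))] 0 := by
    refine ae_eq_zero_of_integral_mul_pow_eq_zero (by fun_prop) ?_ fun k ↦ ?_
    · filter_upwards [gt_mem_nhds ha] with t ht
      refine (hint.const_mul ‖L‖).mono' (by fun_prop) ?_
      filter_upwards [ae_restrict_mem measurableSet_Ioi] with s (hs : 0 < s)
      rw [norm_mul, norm_of_nonneg (exp_pos _).le, mul_left_comm]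
      gcongr
      exact L.le_opNorm _
    · have h := L.integral_comp_comm (hpow k)
      rw [hmom k, map_zero] at h
      refine (integral_congr_ae (.of_forall fun s ↦ ?_)).trans h
      rw [← Complex.ofReal_pow, mul_comm (φ s), ← Complex.real_smul, map_smul, smul_eq_mul,
        mul_comm]
  filter_upwards [key Complex.reCLM, key Complex.imCLM] with s hre him
  exact Complex.ext hre him
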